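/- Let γ < 0 and assume (A.1). Let v : S → ℝ be bounded and measurable, π ∈ S, and B ⊆ S a Borel set. Then the projection measure μ̄_{(π,v)}(B) := E[ 1_B(G(π, w)) e^{γ ln⟨π, w⟩ + v(G(π, w))} ] / E[ e^{γ ln⟨π, w⟩ + v(G(π, w))} ] satisfies μ̄_{(π,v)}(B) ≥ e^{inf v − sup v} · E[ 1_B(G(π, w)) e^{γ r^+} ] / E[ e^{γ r^-} ], where r^+ := max_i r_i and r^- := min_i r_i; here e^{inf v − sup v} = e^{−2‖v‖_sp}. -/

import Mathlib

open MeasureTheory Set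

noncomputable section

/-- Standard scalar product on `ℝ^d`. -/
def ip {d : ℕ} (x y : Fin d → ℝ) : ℝ := ∑ i, x i * y i

/-- `G(x,y) = (x·y)/⟨x,y⟩` (componentwise product, normalised). -/
def Gmap {d : ℕ} (x y : Fin d → ℝ) : Fin d → ℝ := fun i => x i * y i / ip x y

/-- `S_δ`, the set of allocations in the simplex with all weights at least `δ`. -/
def Sdel {d : ℕ} (δ : ℝ) : Set (Fin d → ℝ) := {π ∈ stdSimplex ℝ (Fin d) | ∀ i, δ ≤ π i}

/-- The restricted Bellman operator
`(T_δ v)(π) = sup_{π' ∈ S_δ} [γ ln s(π,π') + ln E[exp(γ ln⟨π',w⟩ + v(G(π',w)))]]`. -/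
def Tdel {d : ℕ} {Ω : Type*} [MeasurableSpace Ω] (P : Measure Ω) (γ : ℝ)
    (s : (Fin d → ℝ) → (Fin d → ℝ) → ℝ) (r : Ω → Fin d → ℝ) (δ : ℝ)
    (v : (Fin d → ℝ) → ℝ) (π : Fin d → ℝ) : ℝ :=
  sSup ((fun π' => γ * Real.log (s π π') +
      Real.log (∫ ω, Real.exp (γ * Real.log (ip π' (fun i => Real.exp (r ω i))) +
        v (Gmap π' (fun i => Real.exp (r ω i)))) ∂P)) '' Sdel δ)

/-- Span seminorm `‖v‖_sp = sup_{π,π' ∈ S} (v(π) − v(π'))/2`. -/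
def spanSemi {d : ℕ} (f : (Fin d → ℝ) → ℝ) : ℝ :=
  sSup {y | ∃ π ∈ stdSimplex ℝ (Fin d), ∃ π' ∈ stdSimplex ℝ (Fin d), y = (f π - f π') / 2}

lemma ip_exp_pos {d : ℕ} {π : Fin d → ℝ} (hπ : π ∈ stdSimplex ℝ (Fin d)) (r : Fin d → ℝ) :
    0 < ip π (fun i => Real.exp (r i)) := by
  have hsum : ∑ i, π i ≠ 0 := by rw [hπ.2]; exact one_ne_zero
  obtain ⟨i, hi, hne⟩ := Finset.exists_ne_zero_of_sum_ne_zero hsum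
  exact Finset.sum_pos' (fun j _ => mul_nonneg (hπ.1 j) (Real.exp_pos _).le)
    ⟨i, hi, mul_pos (lt_of_le_of_ne (hπ.1 i) (Ne.symm hne)) (Real.exp_pos _)⟩

lemma log_ip_exp_le {d : ℕ} {π : Fin d → ℝ} (hπ : π ∈ stdSimplex ℝ (Fin d)) {r : Fin d → ℝ}
    {M : ℝ} (hM : ∀ i, r i ≤ M) : Real.log (ip π (fun i => Real.exp (r i))) ≤ M := by
  rw [Real.log_le_iff_le_exp (ip_exp_pos hπ r)]
  calc ip π (fun i => Real.exp (r i)) ≤ ∑ i, π i * Real.exp M :=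
        Finset.sum_le_sum fun i _ =>
          mul_le_mul_of_nonneg_left (Real.exp_le_exp.2 (hM i)) (hπ.1 i)
    _ = Real.exp M := by rw [← Finset.sum_mul, hπ.2, one_mul]

lemma le_log_ip_exp {d : ℕ} {π : Fin d → ℝ} (hπ : π ∈ stdSimplex ℝ (Fin d)) {r : Fin d → ℝ}
    {m : ℝ} (hm : ∀ i, m ≤ r i) : m ≤ Real.log (ip π (fun i => Real.exp (r i))) := by
  rw [Real.le_log_iff_exp_le (ip_exp_pos hπ r)]
  calc Real.exp m = ∑ i, π i * Real.exp m := by rw [← Finset.sum_mul, hπ.2, one_mul]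
    _ ≤ ip π (fun i => Real.exp (r i)) :=
        Finset.sum_le_sum fun i _ =>
          mul_le_mul_of_nonneg_left (Real.exp_le_exp.2 (hm i)) (hπ.1 i)

lemma Gmap_exp_mem_stdSimplex {d : ℕ} {π : Fin d → ℝ} (hπ : π ∈ stdSimplex ℝ (Fin d))
    (r : Fin d → ℝ) : Gmap π (fun i => Real.exp (r i)) ∈ stdSimplex ℝ (Fin d) := by
  have hpos := ip_exp_pos hπ r
  refine ⟨fun i => div_nonneg (mul_nonneg (hπ.1 i) (Real.exp_pos _).le) hpos.le, ?_⟩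
  simp only [Gmap]
  rw [← Finset.sum_div]
  exact div_self hpos.ne'

/-- Two-sided comparison of a normalised integral with bounds on its numerator weight `f` and on
its normalisation. -/
lemma mul_integral_div_le_integral_div {Ω : Type*} [MeasurableSpace Ω] {P : Measure Ω} [NeZero P]
    {χ f g h : Ω → ℝ} {a b : ℝ} (hχm : Measurable χ) (hχ0 : ∀ ω, 0 ≤ χ ω) (hχ1 : ∀ ω, χ ω ≤ 1)
    (hfm : Measurable f) (hh : Integrable h P) (hg0 : ∀ ω, 0 ≤ g ω) (hf0 : ∀ ω, 0 < f ω)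
    (hgf : ∀ ω, Real.exp a * g ω ≤ f ω) (hfh : ∀ ω, f ω ≤ Real.exp b * h ω) :
    Real.exp (a - b) * (∫ ω, χ ω * g ω ∂P) / (∫ ω, h ω ∂P) ≤
      (∫ ω, χ ω * f ω ∂P) / (∫ ω, f ω ∂P) := by
  have hf : Integrable f P := (hh.const_mul (Real.exp b)).mono' hfm.aestronglyMeasurable
    (.of_forall fun ω => by rw [Real.norm_of_nonneg (hf0 ω).le]; exact hfh ω)
  have hχf : Integrable (fun ω => χ ω * f ω) P :=
    hf.mono' (hχm.mul hfm).aestronglyMeasurable (.of_forall fun ω => by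
      rw [Real.norm_of_nonneg (mul_nonneg (hχ0 ω) (hf0 ω).le)]
      exact mul_le_of_le_one_left (hf0 ω).le (hχ1 ω))
  have hnum : Real.exp a * (∫ ω, χ ω * g ω ∂P) ≤ ∫ ω, χ ω * f ω ∂P := by
    rw [← integral_const_mul]
    refine integral_mono_of_nonneg
      (.of_forall fun ω => mul_nonneg (Real.exp_pos a).le (mul_nonneg (hχ0 ω) (hg0 ω))) hχf
      (.of_forall fun ω => ?_)
    calc Real.exp a * (χ ω * g ω) = χ ω * (Real.exp a * g ω) := by ring
      _ ≤ χ ω * f ω := mul_le_mul_of_nonneg_left (hgf ω) (hχ0 ω)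
  have hden : ∫ ω, f ω ∂P ≤ Real.exp b * ∫ ω, h ω ∂P := by
    rw [← integral_const_mul]
    exact integral_mono hf (hh.const_mul _) hfh
  have hpos : 0 < ∫ ω, f ω ∂P := by
    rw [integral_pos_iff_support_of_nonneg (fun ω => (hf0 ω).le) hf,
      Function.support_eq_univ fun ω => (hf0 ω).ne']
    exact Measure.measure_univ_pos.2 (NeZero.ne P)
  calc Real.exp (a - b) * (∫ ω, χ ω * g ω ∂P) / (∫ ω, h ω ∂P)
      = (Real.exp a * ∫ ω, χ ω * g ω ∂P) / (Real.exp b * ∫ ω, h ω ∂P) := by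
        rw [Real.exp_sub, div_mul_eq_mul_div, div_div]
    _ ≤ (∫ ω, χ ω * f ω ∂P) / (∫ ω, f ω ∂P) :=
        div_le_div₀ (integral_nonneg fun ω => mul_nonneg (hχ0 ω) (hf0 ω).le) hnum hpos hden

/-- The exponential of `γ` times a componentwise minimum is integrable as soon as each component
has an exponential moment. -/
lemma integrable_exp_mul_inf' {ι Ω : Type*} [Fintype ι] [MeasurableSpace Ω] {P : Measure Ω}
    (hι : (Finset.univ : Finset ι).Nonempty) (γ : ℝ) {r : Ω → ι → ℝ} (hr : Measurable r)
    (hexp : ∀ i, Integrable (fun ω => Real.exp (γ * r ω i)) P) :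
    Integrable (fun ω => Real.exp (γ * Finset.univ.inf' hι (fun i => r ω i))) P := by
  have hm : Measurable fun ω => Finset.univ.inf' hι (fun i => r ω i) := by
    have := Finset.inf'_induction hι (fun i ω => r ω i) (p := Measurable)
      (fun _ hf _ hg => hf.inf hg) (fun i _ => (measurable_pi_apply i).comp hr)
    convert this using 1
    ext ω
    simp only [Finset.inf'_apply]
  refine (integrable_finsetSum Finset.univ fun i _ => hexp i).mono'
    (hm.const_mul γ).exp.aestronglyMeasurable (.of_forall fun ω => ?_)
  obtain ⟨i, hi, h⟩ := Finset.exists_mem_eq_inf' hι (fun i => r ω i)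
  rw [Real.norm_of_nonneg (Real.exp_pos _).le, h]
  exact Finset.single_le_sum (f := fun i => Real.exp (γ * r ω i))
    (fun j _ => (Real.exp_pos _).le) hi

/-- for `γ < 0`, under (A.1), for bounded measurable `v`, `π ∈ S` and a
Borel set `B ⊆ S`, the projection measure
`μ̄_{(π,v)}(B) = E[1_B(G(π,w)) e^{γ ln⟨π,w⟩ + v(G(π,w))}] / E[e^{γ ln⟨π,w⟩ + v(G(π,w))}]`
satisfies `μ̄_{(π,v)}(B) ≥ e^{inf v − sup v} E[1_B(G(π,w)) e^{γ r⁺}] / E[e^{γ r⁻}]`. -/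
theorem projection_measure_lower_bound {d : ℕ} (hd : 0 < d) {Ω : Type*} [MeasurableSpace Ω]
    (P : Measure Ω) [IsProbabilityMeasure P]
    (γ : ℝ) (hγ : γ < 0) (r : Ω → Fin d → ℝ) (hrm : Measurable r)
    (hA1exp : ∀ i, Integrable (fun ω => Real.exp (γ * r ω i)) P)
    (hA1int : ∀ i, Integrable (fun ω => r ω i) P)
    (v : (Fin d → ℝ) → ℝ) (hvm : Measurable v)
    (hvb : ∃ C : ℝ, ∀ π, |v π| ≤ C)
    (π : Fin d → ℝ) (hπ : π ∈ stdSimplex ℝ (Fin d))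
    (B : Set (Fin d → ℝ)) (hB : MeasurableSet B) (hBS : B ⊆ stdSimplex ℝ (Fin d)) :
    (∫ ω, Set.indicator B (fun _ => (1 : ℝ)) (Gmap π (fun i => Real.exp (r ω i))) *
          Real.exp (γ * Real.log (ip π (fun i => Real.exp (r ω i))) +
            v (Gmap π (fun i => Real.exp (r ω i)))) ∂P) /
        (∫ ω, Real.exp (γ * Real.log (ip π (fun i => Real.exp (r ω i))) +
          v (Gmap π (fun i => Real.exp (r ω i)))) ∂P) ≥
      Real.exp (sInf (v '' stdSimplex ℝ (Fin d)) - sSup (v '' stdSimplex ℝ (Fin d))) *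
        (∫ ω, Set.indicator B (fun _ => (1 : ℝ)) (Gmap π (fun i => Real.exp (r ω i))) *
          Real.exp (γ * Finset.univ.sup' (Finset.univ_nonempty_iff.mpr ⟨⟨0, hd⟩⟩)
            (fun i => r ω i)) ∂P) /
        (∫ ω, Real.exp (γ * Finset.univ.inf' (Finset.univ_nonempty_iff.mpr ⟨⟨0, hd⟩⟩)
          (fun i => r ω i)) ∂P) := by
  obtain ⟨C, hC⟩ := hvb
  have hbelow : BddBelow (v '' stdSimplex ℝ (Fin d)) :=
    ⟨-C, forall_mem_image.2 fun x _ => (abs_le.1 (hC x)).1⟩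
  have habove : BddAbove (v '' stdSimplex ℝ (Fin d)) :=
    ⟨C, forall_mem_image.2 fun x _ => (abs_le.1 (hC x)).2⟩
  have hG ω := Gmap_exp_mem_stdSimplex hπ (r ω)
  have hri i : Measurable fun ω => Real.exp (r ω i) :=
    ((measurable_pi_apply i).comp hrm).exp
  have hipm : Measurable fun ω => ip π (fun i => Real.exp (r ω i)) :=
    Finset.measurable_fun_sum _ fun i _ => (hri i).const_mul (π i)
  have hGm : Measurable fun ω => Gmap π (fun i => Real.exp (r ω i)) :=
    measurable_pi_lambda _ fun i => ((hri i).const_mul (π i)).div hipm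
  refine mul_integral_div_le_integral_div
    ((measurable_const.indicator hB).comp hGm)
    (fun ω => indicator_nonneg (fun _ _ => zero_le_one) _)
    (fun ω => indicator_le_self' (fun _ _ => zero_le_one) _)
    ((hipm.log.const_mul γ).add (hvm.comp hGm)).exp
    (integrable_exp_mul_inf' _ γ hrm hA1exp)
    (fun ω => (Real.exp_pos _).le) (fun ω => Real.exp_pos _) (fun ω => ?_) (fun ω => ?_)
  · rw [← Real.exp_add, Real.exp_le_exp, add_comm]
    exact add_le_add
      (mul_le_mul_of_nonpos_left
        (log_ip_exp_le hπ fun i => Finset.le_sup' (fun i => r ω i) (Finset.mem_univ i)) hγ.le)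
      (csInf_le hbelow (mem_image_of_mem v (hG ω)))
  · rw [← Real.exp_add, Real.exp_le_exp, add_comm (sSup _)]
    exact add_le_add
      (mul_le_mul_of_nonpos_left
        (le_log_ip_exp hπ fun i => Finset.inf'_le (fun i => r ω i) (Finset.mem_univ i)) hγ.le)
      (le_csSup habove (mem_image_of_mem v (hG ω)))
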